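/- Let C be a symmetric n×n real matrix that is diagonally dominant with nonnegative diagonal entries and Tr(C) > 0, and let ε ∈ (0,1). Set M = 4·log(2n)/ε and β = 4·Tr(C). Suppose X⋆ is in the MaxCut SDP feasible set and y⋆ ∈ ℝ^n satisfies diag*(y⋆) − C ⪰ 0 and ∑_{i=1}^n y⋆_i = ⟨C,X⋆⟩. Suppose X̂ ⪰ 0 with Tr(X̂) ≤ n satisfies ⟨C,X̂⟩ − β·φ_M(diag(X̂) − 𝟙) ≥ ⟨C,X⟩ − β·φ_M(diag(X) − 𝟙) − ε·Tr(C) for every X ⪰ 0 with Tr(X) ≤ n. Then (1 − ε)·⟨C,X⋆⟩ ≤ ⟨C,X̂⟩ ≤ (1 + ε)·⟨C,X⋆⟩ and ‖diag(X̂) − 𝟙‖_∞ ≤ ε. -/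

import Mathlib

/-- The LogSumExp penalty `φ_M(v) = (1/M)·log (∑ i, e^{M v_i} + ∑ i, e^{-M v_i})`. -/
noncomputable def logSumExpPenalty (d : ℕ) (M : ℝ) (v : Fin d → ℝ) : ℝ :=
  (1 / M) * Real.log (∑ i, Real.exp (M * v i) + ∑ i, Real.exp (-(M * v i)))

/-- The trace inner product `⟨A, B⟩ = Tr(Aᵀ B)` on `n × n` real matrices. -/
noncomputable def traceInner {n : ℕ} (A B : Matrix (Fin n) (Fin n) ℝ) : ℝ :=
  (A.transpose * B).trace

/-- The MaxCut SDP feasible set `{X ∈ 𝕊^n : X ⪰ 0, diag(X) = 𝟙}`. -/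
def maxCutFeasible (n : ℕ) : Set (Matrix (Fin n) (Fin n) ℝ) :=
  {X | X.PosSemidef ∧ ∀ i, X i i = 1}

theorem traceInner_eq_sum {n : ℕ} (A B : Matrix (Fin n) (Fin n) ℝ) :
    traceInner A B = ∑ i, ∑ j, A i j * B i j := by
  simp only [traceInner, Matrix.trace, Matrix.diag_apply, Matrix.mul_apply, Matrix.transpose_apply]
  exact Finset.sum_comm

theorem traceInner_nonneg {n : ℕ} {A B : Matrix (Fin n) (Fin n) ℝ}
    (hA : A.PosSemidef) (hB : B.PosSemidef) : 0 ≤ traceInner A B := by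
  have h := (hA.hadamard hB).dotProduct_mulVec_nonneg (fun _ => 1)
  simpa [traceInner_eq_sum, dotProduct, Matrix.mulVec, Matrix.hadamard_apply] using h

theorem traceInner_diagonal_sub {n : ℕ} (y : Fin n → ℝ) (C X : Matrix (Fin n) (Fin n) ℝ) :
    traceInner (Matrix.diagonal y - C) X = ∑ i, y i * X i i - traceInner C X := by
  simp [traceInner, sub_mul, Matrix.trace, Matrix.diagonal_transpose,
    Matrix.diagonal_mul]

theorem abs_apply_le_one_of_mem_maxCutFeasible {n : ℕ} {X : Matrix (Fin n) (Fin n) ℝ}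
    (hX : X ∈ maxCutFeasible n) (i j : Fin n) : |X i j| ≤ 1 := by
  have h := (hX.1.submatrix ![i, j]).det_nonneg
  have hs : X j i = X i j := by simpa using hX.1.isHermitian.apply i j
  simp only [Matrix.det_fin_two, Matrix.submatrix_apply, Matrix.cons_val_zero,
    Matrix.cons_val_one, hX.2, hs] at h
  exact abs_le_one_iff_mul_self_le_one.mpr (by linarith)

theorem traceInner_le_two_mul_trace {n : ℕ} {C X : Matrix (Fin n) (Fin n) ℝ}
    (hdd : ∀ i, ∑ j ∈ Finset.univ.erase i, |C i j| ≤ C i i) (hX : X ∈ maxCutFeasible n) :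
    traceInner C X ≤ 2 * C.trace := by
  rw [traceInner_eq_sum, Matrix.trace, Finset.mul_sum]
  refine Finset.sum_le_sum fun i _ => ?_
  rw [← Finset.add_sum_erase _ _ (Finset.mem_univ i), hX.2, Matrix.diag_apply]
  have h : ∑ j ∈ Finset.univ.erase i, C i j * X i j ≤ ∑ j ∈ Finset.univ.erase i, |C i j| := by
    refine Finset.sum_le_sum fun j _ => (le_abs_self _).trans ?_
    rw [abs_mul]
    exact mul_le_of_le_one_right (abs_nonneg _) (abs_apply_le_one_of_mem_maxCutFeasible hX i j)
  linarith [hdd i]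

theorem abs_le_logSumExpPenalty {d : ℕ} {M : ℝ} (hM : 0 < M) (v : Fin d → ℝ) (i : Fin d) :
    |v i| ≤ logSumExpPenalty d M v := by
  have h₁ := Finset.single_le_sum (f := fun i => Real.exp (M * v i))
    (fun j _ => (Real.exp_pos _).le) (Finset.mem_univ i)
  have h₂ := Finset.single_le_sum (f := fun i => Real.exp (-(M * v i)))
    (fun j _ => (Real.exp_pos _).le) (Finset.mem_univ i)
  have h₃ := Real.exp_pos (M * v i)
  have h₄ := Real.exp_pos (-(M * v i))
  have h : M * |v i| ≤
      Real.log (∑ i, Real.exp (M * v i) + ∑ i, Real.exp (-(M * v i))) := by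
    rw [Real.le_log_iff_exp_le (by linarith)]
    rcases abs_choice (v i) with h | h <;> rw [h]
    · linarith
    · rw [mul_neg]; linarith
  rw [logSumExpPenalty, one_div, ← div_eq_inv_mul, le_div_iff₀ hM]
  linarith

theorem logSumExpPenalty_zero (d : ℕ) (M : ℝ) :
    logSumExpPenalty d M (fun _ => 0) = Real.log (2 * d) / M := by
  simp only [logSumExpPenalty, mul_zero, neg_zero, Real.exp_zero, Finset.sum_const,
    Finset.card_univ, Fintype.card_fin, nsmul_eq_mul, mul_one]
  rw [two_mul]
  ring

theorem log_div_le_logSumExpPenalty {d : ℕ} (hd : 0 < d) {M : ℝ} (hM : 0 < M) (v : Fin d → ℝ) :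
    Real.log (2 * d) / M ≤ logSumExpPenalty d M v := by
  have hd' : (0 : ℝ) < d := by exact_mod_cast hd
  have h : (2 * d : ℝ) ≤ ∑ i, Real.exp (M * v i) + ∑ i, Real.exp (-(M * v i)) := by
    rw [← Finset.sum_add_distrib]
    have := Finset.card_nsmul_le_sum Finset.univ
      (fun i => Real.exp (M * v i) + Real.exp (-(M * v i))) 2 fun i _ => by
        linarith [Real.one_le_cosh (M * v i), Real.cosh_eq (M * v i)]
    simpa [mul_comm] using this
  rw [logSumExpPenalty, one_div, ← div_eq_inv_mul]
  gcongr

/-- **Relative error bounds for the penalized MaxCut SDP.**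
Let `C` be symmetric, diagonally dominant with nonnegative diagonal, with `Tr C > 0`,
let `ε ∈ (0,1)`, `M = 4 log(2n)/ε` and `β = 4 Tr C`.  Let `(X⋆, y⋆)` be a primal–dual
optimal pair with zero duality gap (`X⋆` feasible, `diag*(y⋆) - C ⪰ 0`,
`∑ i, y⋆ i = ⟨C, X⋆⟩`), and let `X̂ ⪰ 0` with `Tr X̂ ≤ n` be `ε·Tr C`-optimal for the
LogSumExp-penalized trace-constrained problem.  Then
`(1-ε)⟨C,X⋆⟩ ≤ ⟨C,X̂⟩ ≤ (1+ε)⟨C,X⋆⟩` and `‖diag(X̂) - 𝟙‖_∞ ≤ ε`.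
(The norm on `Fin n → ℝ` is the sup norm.) -/
theorem maxCut_penalized_relative_bounds {n : ℕ}
    (C : Matrix (Fin n) (Fin n) ℝ) (hC : C.IsSymm)
    (hdd : ∀ i, ∑ j ∈ Finset.univ.erase i, |C i j| ≤ C i i)
    (htr : 0 < C.trace)
    (ε : ℝ) (hε : ε ∈ Set.Ioo (0:ℝ) 1)
    (M β : ℝ) (hM : M = 4 * Real.log (2 * n) / ε) (hβ : β = 4 * C.trace)
    (Xstar : Matrix (Fin n) (Fin n) ℝ) (hXstar : Xstar ∈ maxCutFeasible n)
    (ystar : Fin n → ℝ) (hystar : (Matrix.diagonal ystar - C).PosSemidef)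
    (hdual : ∑ i, ystar i = traceInner C Xstar)
    (Xhat : Matrix (Fin n) (Fin n) ℝ) (hXhat : Xhat.PosSemidef)
    (hXhat_tr : Xhat.trace ≤ (n : ℝ))
    (hXhat_opt : ∀ X : Matrix (Fin n) (Fin n) ℝ, X.PosSemidef → X.trace ≤ (n : ℝ) →
      traceInner C Xhat - β * logSumExpPenalty n M (fun i => Xhat i i - 1) ≥
        traceInner C X - β * logSumExpPenalty n M (fun i => X i i - 1) - ε * C.trace) :
    ((1 - ε) * traceInner C Xstar ≤ traceInner C Xhat ∧
        traceInner C Xhat ≤ (1 + ε) * traceInner C Xstar) ∧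
      ‖(fun i => Xhat i i - 1)‖ ≤ ε := by
  obtain ⟨hε₀, -⟩ := hε
  have hn : 0 < n := by
    rcases Nat.eq_zero_or_pos n with rfl | h
    · simp [Matrix.trace] at htr
    · exact h
  have hn' : (1 : ℝ) ≤ n := by exact_mod_cast hn
  have hlog : 0 < Real.log (2 * n) := Real.log_pos (by linarith)
  have hMpos : 0 < M := by rw [hM]; positivity
  have hlogM : Real.log (2 * n) / M = ε / 4 := by rw [hM]; field_simp
  set δ := ‖(fun i => Xhat i i - 1)‖
  set φ := logSumExpPenalty n M (fun i => Xhat i i - 1)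
  have hδ₀ : 0 ≤ δ := norm_nonneg _
  have hδφ : δ ≤ φ := by
    have h := abs_le_logSumExpPenalty hMpos (fun i => Xhat i i - 1)
    exact (pi_norm_le_iff_of_nonneg ((abs_nonneg _).trans (h ⟨0, hn⟩))).2 h
  have hεφ : ε / 4 ≤ φ := hlogM ▸ log_div_le_logSumExpPenalty hn hMpos _
  have hopt := hXhat_opt Xstar hXstar.1 (by simp [Matrix.trace, hXstar.2])
  simp only [hXstar.2, sub_self, logSumExpPenalty_zero, hlogM, hβ] at hopt
  have hyC (i : Fin n) : C i i ≤ ystar i := by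
    simpa using hystar.diag_nonneg (i := i)
  have hy₀ (i : Fin n) : 0 ≤ ystar i :=
    ((Finset.sum_nonneg fun _ _ => abs_nonneg _).trans (hdd i)).trans (hyC i)
  have htrace_le : C.trace ≤ traceInner C Xstar :=
    hdual ▸ Finset.sum_le_sum fun i _ => hyC i
  have hle_trace := traceInner_le_two_mul_trace hdd hXstar
  have hupper : traceInner C Xhat ≤ (1 + δ) * traceInner C Xstar := by
    have h := traceInner_nonneg hystar hXhat
    rw [traceInner_diagonal_sub] at h
    have : ∑ i, ystar i * Xhat i i ≤ (1 + δ) * ∑ i, ystar i := by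
      rw [Finset.mul_sum]
      refine Finset.sum_le_sum fun i _ => ?_
      have hi : Xhat i i - 1 ≤ δ :=
        (le_abs_self _).trans (norm_le_pi_norm (fun i => Xhat i i - 1) i)
      rw [mul_comm]
      exact mul_le_mul_of_nonneg_right (by linarith) (hy₀ i)
    rw [hdual] at this
    linarith
  have hδε : δ ≤ ε := by
    have h₁ := mul_le_mul_of_nonneg_left hδφ htr.le
    have h₂ := mul_le_mul_of_nonneg_left hle_trace hδ₀
    refine le_of_mul_le_mul_left ?_ htr
    linarith
  refine ⟨⟨?_, hupper.trans ?_⟩, hδε⟩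
  · have h₁ := mul_le_mul_of_nonneg_left hεφ htr.le
    have h₂ := mul_le_mul_of_nonneg_left htrace_le hε₀.le
    linarith
  · exact mul_le_mul_of_nonneg_right (by linarith) (htr.le.trans htrace_le)
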